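/- arXiv:1912.10529 — 3 statements merged into one kernel-verified Lean document; each statement's English description precedes it below -/
import Mathlib

section
/- Let X_1,…,X_n and Y_1,…,Y_n be sequences of (deterministic) vectors in R^p, let U be uniformly distributed on [0,1], and let σ be uniformly distributed on the set S_n of all bijections of {1,…,n}, with U and σ independent. For k = 1,…,n set W_k^σ = Σ_{j=1}^{k−1} X_{σ(j)} + Σ_{j=k+1}^n Y_{σ(j)}, and define W_k = W_{σ^{-1}(k)}^σ + X_k if U ≤ σ^{-1}(k)/(n+1) and W_k = W_{σ^{-1}(k)}^σ + Y_k otherwise. Then the distribution of W_k does not depend on k; moreover, there exists a random vector ε = (ε_1,…,ε_n) with values in {0,1}^n such that for every k the distribution of W_k equals that of Σ_{i=1}^n (ε_i X_i + (1−ε_i) Y_i), the random variables ε_1,…,ε_n are exchangeable, P(Σ_{i=1}^n ε_i = s) = 1/(n+1) for all s = 0,…,n, and E[Σ_{i=1}^n ε_i] = n/2. -/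
open MeasureTheory ProbabilityTheory

/-- The interpolation vector `W_k` of the randomized Lindeberg method:
`W_k = W^σ_{σ⁻¹(k)} + X_k` if `U ≤ σ⁻¹(k)/(n+1)` and `W_k = W^σ_{σ⁻¹(k)} + Y_k`
otherwise, where `W^σ_m = Σ_{j<m} X_{σ(j)} + Σ_{j>m} Y_{σ(j)}` (positions are
`1`-based in the paper; here `Fin n` is `0`-based, so position `m` corresponds to
the `1`-based value `m + 1`). -/
noncomputable def lindW {n p : ℕ} (X Y : Fin n → Fin p → ℝ) {Ω : Type}
    (U : Ω → ℝ) (σ : Ω → Equiv.Perm (Fin n)) (k : Fin n) (ω : Ω) : Fin p → ℝ :=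
  fun j =>
    (∑ j' ∈ Finset.univ.filter fun j' => j' < (σ ω)⁻¹ k, X (σ ω j') j) +
    (∑ j' ∈ Finset.univ.filter fun j' => (σ ω)⁻¹ k < j', Y (σ ω j') j) +
    (if U ω ≤ ((((σ ω)⁻¹ k : Fin n) : ℕ) + 1 : ℝ) / (n + 1) then X k j else Y k j)

/-- The elements placed by the permutation `π` strictly before `k`. -/
def precedingSet {n : ℕ} (π : Equiv.Perm (Fin n)) (k : Fin n) : Finset (Fin n) :=
  {x | π⁻¹ x < π⁻¹ k}

lemma mem_precedingSet {n : ℕ} {π : Equiv.Perm (Fin n)} {k x : Fin n} :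
    x ∈ precedingSet π k ↔ π⁻¹ x < π⁻¹ k := by
  simp [precedingSet]

lemma notMem_precedingSet {n : ℕ} (π : Equiv.Perm (Fin n)) (k : Fin n) :
    k ∉ precedingSet π k := by
  simp [mem_precedingSet]

lemma card_precedingSet {n : ℕ} (π : Equiv.Perm (Fin n)) (k : Fin n) :
    (precedingSet π k).card = (π⁻¹ k : Fin n) := by
  rw [← Fin.card_Iio (π⁻¹ k)]
  refine Finset.card_bij (fun x _ => π⁻¹ x) ?_ ?_ ?_
  · intro x hx
    simpa [mem_precedingSet] using hx
  · intro x _ y _ h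
    exact π⁻¹.injective h
  · intro y hy
    exact ⟨π y, by simpa [mem_precedingSet] using hy, by simp⟩

lemma card_perm_isPrefix {n : ℕ} (T : Finset (Fin n)) :
    (Finset.univ.filter fun π : Equiv.Perm (Fin n) =>
      ∀ x, x ∈ T ↔ ((π⁻¹ x : Fin n) : ℕ) < T.card).card =
      T.card.factorial * (n - T.card).factorial := by
  have h := Numbering.card_prefixed T
  rw [Fintype.card_fin] at h
  rw [← h]
  let e : Equiv.Perm (Fin n) ≃ Numbering (Fin n) :=
    (Equiv.inv (Equiv.Perm (Fin n))).trans
      (Equiv.equivCongr (Equiv.refl _) (finCongr (Fintype.card_fin n).symm))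
  refine Finset.card_equiv e fun π => ?_
  simp [Numbering.mem_prefixed, Numbering.IsPrefix, e, Equiv.equivCongr]

lemma card_precedingSet_eq_of_notMem {n : ℕ} (T : Finset (Fin n)) {k k' : Fin n}
    (hk : k ∉ T) (hk' : k' ∉ T) :
    (Finset.univ.filter fun π : Equiv.Perm (Fin n) => precedingSet π k = T).card =
      (Finset.univ.filter fun π : Equiv.Perm (Fin n) => precedingSet π k' = T).card := by
  refine Finset.card_equiv (Equiv.mulLeft (Equiv.swap k k')) fun π => ?_
  simp only [Finset.mem_filter, Finset.mem_univ, true_and, Finset.ext_iff, mem_precedingSet,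
    Equiv.coe_mulLeft, mul_inv_rev, Equiv.swap_inv, Equiv.Perm.mul_apply, Equiv.swap_apply_right]
  have hT (x : Fin n) : Equiv.swap k k' x ∈ T ↔ x ∈ T := by
    rcases eq_or_ne x k with rfl | h1
    · simp [hk, hk']
    rcases eq_or_ne x k' with rfl | h2
    · simp [hk, hk']
    rw [Equiv.swap_apply_of_ne_of_ne h1 h2]
  constructor
  · intro h x
    rw [h, hT]
  · intro h x
    simpa [hT] using h (Equiv.swap k k' x)

lemma card_precedingSet_eq {n : ℕ} (T : Finset (Fin n)) {k : Fin n} (hk : k ∉ T) :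
    (n - T.card) * (Finset.univ.filter fun π : Equiv.Perm (Fin n) =>
      precedingSet π k = T).card = T.card.factorial * (n - T.card).factorial := by
  have hlt : T.card < n := by
    simpa using Finset.card_lt_univ_of_notMem hk
  rw [← card_perm_isPrefix T,
    Finset.card_eq_sum_card_fiberwise
      (s := Finset.univ.filter fun π : Equiv.Perm (Fin n) =>
        ∀ x, x ∈ T ↔ ((π⁻¹ x : Fin n) : ℕ) < T.card)
      (f := fun π : Equiv.Perm (Fin n) => π ⟨T.card, hlt⟩) (t := Tᶜ)]
  · rw [Finset.sum_congr rfl (g := fun _ => (Finset.univ.filter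
      fun π : Equiv.Perm (Fin n) => precedingSet π k = T).card)]
    · simp [Finset.card_compl]
    intro k' hk'
    rw [card_precedingSet_eq_of_notMem T hk (Finset.mem_compl.1 hk'), Finset.filter_filter]
    congr 1
    ext π
    simp only [Finset.mem_filter, Finset.mem_univ, true_and]
    constructor
    · rintro ⟨hpre, rfl⟩
      ext x
      simp [mem_precedingSet, hpre x, Fin.lt_def]
    · intro h
      have hc : T.card = (π⁻¹ k' : Fin n) := by rw [← h, card_precedingSet]
      refine ⟨fun x => ?_, ?_⟩
      · rw [hc, ← Fin.lt_def, ← mem_precedingSet, h]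
      · have : (⟨T.card, hlt⟩ : Fin n) = π⁻¹ k' := Fin.ext hc
        simp [this]
  · intro π hπ
    simp only [Finset.coe_filter, Finset.mem_univ, true_and, Set.mem_ofPred_eq] at hπ
    simp [hπ]

/-- The probability of `S` under the law on subsets of `Fin n` for which the cardinality is
uniform on `{0, …, n}` and all subsets of the same cardinality are equally likely. -/
noncomputable def uniformCardWeight {n : ℕ} (S : Finset (Fin n)) : ℝ :=
  (S.card.factorial * (n - S.card).factorial : ℝ) / (n + 1).factorial

lemma uniformCardWeight_nonneg {n : ℕ} (S : Finset (Fin n)) : 0 ≤ uniformCardWeight S := by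
  unfold uniformCardWeight
  positivity

lemma sum_uniformCardWeight_mul {n : ℕ} (f : ℕ → ℝ) :
    ∑ S : Finset (Fin n), uniformCardWeight S * f S.card =
      ∑ s ∈ Finset.range (n + 1), f s / (n + 1) := by
  have h := Finset.sum_powerset_apply_card
    (fun s => (s.factorial * (n - s).factorial : ℝ) / (n + 1).factorial * f s)
    (x := (Finset.univ : Finset (Fin n)))
  rw [Finset.powerset_univ, Finset.card_univ, Fintype.card_fin] at h
  unfold uniformCardWeight
  rw [h]
  refine Finset.sum_congr rfl fun s hs => ?_
  have hs : s ≤ n := Nat.lt_succ_iff.1 (Finset.mem_range.1 hs)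
  have hc : (n.choose s : ℝ) * s.factorial * (n - s).factorial = n.factorial := by
    exact_mod_cast Nat.choose_mul_factorial_mul_factorial hs
  rw [nsmul_eq_mul, Nat.factorial_succ, Nat.cast_mul, ← hc]
  have := Nat.choose_pos hs
  push_cast
  field_simp

lemma sum_uniformCardWeight (n : ℕ) : ∑ S : Finset (Fin n), uniformCardWeight S = 1 := by
  have h := sum_uniformCardWeight_mul (n := n) fun _ => 1
  simp only [mul_one] at h
  rw [h, Finset.sum_const, Finset.card_range, nsmul_eq_mul]
  push_cast
  field_simp

/-- The law of a random subset of `Fin n` with uniform cardinality and, given its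
cardinality, uniformly distributed. -/
noncomputable def uniformCardPMF (n : ℕ) : PMF (Finset (Fin n)) :=
  PMF.ofFintype (fun S => ENNReal.ofReal (uniformCardWeight S)) (by
    rw [← ENNReal.ofReal_sum_of_nonneg fun S _ => uniformCardWeight_nonneg S,
      sum_uniformCardWeight, ENNReal.ofReal_one])

lemma uniformCardPMF_apply {n : ℕ} (S : Finset (Fin n)) :
    uniformCardPMF n S = ENNReal.ofReal (uniformCardWeight S) := rfl

/-- The set of indices of the vectors `X i` which occur in `lindW X Y U σ k`. -/
noncomputable def lindSet {n : ℕ} {Ω : Type} (U : Ω → ℝ) (σ : Ω → Equiv.Perm (Fin n))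
    (k : Fin n) (ω : Ω) : Finset (Fin n) :=
  if U ω ≤ ((((σ ω)⁻¹ k : Fin n) : ℕ) + 1 : ℝ) / (n + 1) then insert k (precedingSet (σ ω) k)
  else precedingSet (σ ω) k

/-- The sum `Σ_i (ε_i X_i + (1 - ε_i) Y_i)` for `ε` the indicator function of `S`. -/
noncomputable def mixedSum {n p : ℕ} (X Y : Fin n → Fin p → ℝ) (S : Finset (Fin n)) :
    Fin p → ℝ :=
  fun j => ∑ i, ((if i ∈ S then 1 else 0) * X i j + (1 - if i ∈ S then 1 else 0) * Y i j)

lemma lindW_eq_mixedSum {n p : ℕ} (X Y : Fin n → Fin p → ℝ) {Ω : Type}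
    (U : Ω → ℝ) (σ : Ω → Equiv.Perm (Fin n)) (k : Fin n) :
    lindW X Y U σ k = mixedSum X Y ∘ lindSet U σ k := by
  ext ω j
  have hX : ∑ j' ∈ Finset.univ.filter (fun j' => j' < (σ ω)⁻¹ k), X (σ ω j') j =
      ∑ i, if (σ ω)⁻¹ i < (σ ω)⁻¹ k then X i j else 0 := by
    rw [Finset.sum_filter, ← Equiv.sum_comp (σ ω) fun i =>
      if (σ ω)⁻¹ i < (σ ω)⁻¹ k then X i j else 0]
    simp
  have hY : ∑ j' ∈ Finset.univ.filter (fun j' => (σ ω)⁻¹ k < j'), Y (σ ω j') j =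
      ∑ i, if (σ ω)⁻¹ k < (σ ω)⁻¹ i then Y i j else 0 := by
    rw [Finset.sum_filter, ← Equiv.sum_comp (σ ω) fun i =>
      if (σ ω)⁻¹ k < (σ ω)⁻¹ i then Y i j else 0]
    simp
  simp only [lindW, Function.comp_apply, mixedSum]
  rw [hX, hY, ← Finset.sum_add_distrib]
  rw [← Fintype.sum_ite_eq' k fun i =>
      if U ω ≤ ((((σ ω)⁻¹ k : Fin n) : ℕ) + 1 : ℝ) / (n + 1) then X i j else Y i j,
    ← Finset.sum_add_distrib]
  refine Finset.sum_congr rfl fun i _ => ?_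
  rcases lt_trichotomy ((σ ω)⁻¹ i) ((σ ω)⁻¹ k) with h | h | h
  · have hne : i ≠ k := by rintro rfl; exact h.false
    have hmem : i ∈ lindSet U σ k ω := by
      unfold lindSet; split_ifs <;> simp [-Equiv.Perm.coe_inv, mem_precedingSet, h]
    simp [-Equiv.Perm.coe_inv, h, h.not_gt, hne, hmem]
  · obtain rfl := (σ ω)⁻¹.injective h
    have hmem : i ∈ lindSet U σ i ω ↔
        U ω ≤ ((((σ ω)⁻¹ i : Fin n) : ℕ) + 1 : ℝ) / (n + 1) := by
      unfold lindSet; split_ifs with h <;> simp [-Equiv.Perm.coe_inv, notMem_precedingSet, h]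
    simp only [hmem]
    split_ifs <;> simp_all
  · have hne : i ≠ k := by rintro rfl; exact h.false
    have hmem : i ∉ lindSet U σ k ω := by
      unfold lindSet; split_ifs <;> simp [-Equiv.Perm.coe_inv, mem_precedingSet, h.le, hne]
    simp [-Equiv.Perm.coe_inv, h, h.not_gt, hne, hmem]

lemma lindSet_eq_iff_of_mem {n : ℕ} {Ω : Type} (U : Ω → ℝ) (σ : Ω → Equiv.Perm (Fin n))
    {k : Fin n} {S : Finset (Fin n)} (hk : k ∈ S) (ω : Ω) :
    lindSet U σ k ω = S ↔
      U ω ≤ (S.card : ℝ) / (n + 1) ∧ precedingSet (σ ω) k = S.erase k := by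
  have hcard := card_precedingSet (σ ω) k
  have hnot := notMem_precedingSet (σ ω) k
  have hS := Finset.card_erase_add_one hk
  constructor
  · intro h
    unfold lindSet at h
    split_ifs at h with hU
    · have hp : precedingSet (σ ω) k = S.erase k := by rw [← h, Finset.erase_insert hnot]
      refine ⟨?_, hp⟩
      rw [← hS, ← hp, hcard]
      exact_mod_cast hU
    · exact absurd (h ▸ hk) hnot
  · rintro ⟨hU, hp⟩
    rw [← hS, ← hp, hcard] at hU
    rw [lindSet, if_pos (by exact_mod_cast hU), hp, Finset.insert_erase hk]

lemma lindSet_eq_iff_of_notMem {n : ℕ} {Ω : Type} (U : Ω → ℝ) (σ : Ω → Equiv.Perm (Fin n))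
    {k : Fin n} {S : Finset (Fin n)} (hk : k ∉ S) (ω : Ω) :
    lindSet U σ k ω = S ↔
      ((S.card : ℝ) + 1) / (n + 1) < U ω ∧ precedingSet (σ ω) k = S := by
  have hcard := card_precedingSet (σ ω) k
  constructor
  · intro h
    unfold lindSet at h
    split_ifs at h with hU
    · exact absurd (h ▸ Finset.mem_insert_self _ _) hk
    · refine ⟨?_, h⟩
      rw [← h, hcard]
      exact not_le.1 hU
  · rintro ⟨hU, hp⟩
    rw [← hp, hcard] at hU
    rw [lindSet, if_neg (not_le.2 hU), hp]

section

variable {Ω : Type} [MeasurableSpace Ω] {P : Measure Ω} {n : ℕ}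
  {U : Ω → ℝ} {σ : Ω → Equiv.Perm (Fin n)}

lemma measurableSet_perm_mem (hσmeas : ∀ π : Equiv.Perm (Fin n), MeasurableSet {ω | σ ω = π})
    (F : Finset (Equiv.Perm (Fin n))) : MeasurableSet {ω | σ ω ∈ F} := by
  have h : {ω | σ ω ∈ F} = ⋃ π ∈ F, {ω | σ ω = π} := by ext; simp
  rw [h]
  exact F.measurableSet_biUnion fun π _ => hσmeas π

lemma measure_inter_perm_mem (hU : Measurable U)
    (hUlaw : Measure.map U P = volume.restrict (Set.Icc (0 : ℝ) 1))
    (hσmeas : ∀ π : Equiv.Perm (Fin n), MeasurableSet {ω | σ ω = π})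
    (hσlaw : ∀ π : Equiv.Perm (Fin n),
      P {ω | σ ω = π} = ((Nat.factorial n : ENNReal))⁻¹)
    (hindep : ∀ s : Set ℝ, MeasurableSet s → ∀ π : Equiv.Perm (Fin n),
      P ({ω | U ω ∈ s} ∩ {ω | σ ω = π}) = P {ω | U ω ∈ s} * P {ω | σ ω = π})
    {B : Set ℝ} (hB : MeasurableSet B) (F : Finset (Equiv.Perm (Fin n))) :
    P {ω | U ω ∈ B ∧ σ ω ∈ F} =
      volume (B ∩ Set.Icc 0 1) * ENNReal.ofReal (F.card / n.factorial) := by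
  have h : {ω | U ω ∈ B ∧ σ ω ∈ F} = ⋃ π ∈ F, ({ω | U ω ∈ B} ∩ {ω | σ ω = π}) := by
    ext; simp
  have hUB : P {ω | U ω ∈ B} = volume (B ∩ Set.Icc 0 1) := by
    rw [← Measure.restrict_apply hB, ← hUlaw, Measure.map_apply hU hB]
    rfl
  rw [h, measure_biUnion_finset]
  · simp only [hindep B hB, hσlaw, hUB, Finset.sum_const, nsmul_eq_mul]
    rw [ENNReal.ofReal_div_of_pos (by positivity), ENNReal.ofReal_natCast,
      ENNReal.ofReal_natCast, div_eq_mul_inv]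
    ring
  · intro π _ π' _ hne
    refine Set.disjoint_left.2 fun ω h1 h2 => hne ?_
    exact h1.2.symm.trans h2.2
  · exact fun π _ => (hU hB).inter (hσmeas π)

lemma measurableSet_lindSet_eq (hU : Measurable U)
    (hσmeas : ∀ π : Equiv.Perm (Fin n), MeasurableSet {ω | σ ω = π})
    (k : Fin n) (S : Finset (Fin n)) : MeasurableSet {ω | lindSet U σ k ω = S} := by
  by_cases hk : k ∈ S
  · simp only [lindSet_eq_iff_of_mem U σ hk]
    refine (measurableSet_le hU measurable_const).inter ?_
    have h := measurableSet_perm_mem hσmeas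
      (Finset.univ.filter fun π => precedingSet π k = S.erase k)
    simp only [Finset.mem_filter, Finset.mem_univ, true_and] at h
    exact h
  · simp only [lindSet_eq_iff_of_notMem U σ hk]
    refine (measurableSet_lt measurable_const hU).inter ?_
    have h := measurableSet_perm_mem hσmeas
      (Finset.univ.filter fun π => precedingSet π k = S)
    simp only [Finset.mem_filter, Finset.mem_univ, true_and] at h
    exact h

lemma measure_lindSet_eq (hU : Measurable U)
    (hUlaw : Measure.map U P = volume.restrict (Set.Icc (0 : ℝ) 1))
    (hσmeas : ∀ π : Equiv.Perm (Fin n), MeasurableSet {ω | σ ω = π})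
    (hσlaw : ∀ π : Equiv.Perm (Fin n),
      P {ω | σ ω = π} = ((Nat.factorial n : ENNReal))⁻¹)
    (hindep : ∀ s : Set ℝ, MeasurableSet s → ∀ π : Equiv.Perm (Fin n),
      P ({ω | U ω ∈ s} ∩ {ω | σ ω = π}) = P {ω | U ω ∈ s} * P {ω | σ ω = π})
    (k : Fin n) (S : Finset (Fin n)) :
    P {ω | lindSet U σ k ω = S} = ENNReal.ofReal (uniformCardWeight S) := by
  have hSn : S.card ≤ n := by simpa using S.card_le_univ
  by_cases hk : k ∈ S
  · have hev : {ω | lindSet U σ k ω = S} = {ω | U ω ∈ Set.Iic ((S.card : ℝ) / (n + 1)) ∧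
        σ ω ∈ Finset.univ.filter fun π => precedingSet π k = S.erase k} := by
      ext ω
      simp [lindSet_eq_iff_of_mem U σ hk]
    have hint : Set.Iic ((S.card : ℝ) / (n + 1)) ∩ Set.Icc 0 1 =
        Set.Icc 0 ((S.card : ℝ) / (n + 1)) := by
      have hle : (S.card : ℝ) / (n + 1) ≤ 1 := by
        rw [div_le_one (by positivity)]
        exact_mod_cast hSn.trans n.le_succ
      ext x
      simp only [Set.mem_inter_iff, Set.mem_Iic, Set.mem_Icc]
      exact ⟨fun h => ⟨h.2.1, h.1⟩, fun h => ⟨h.2, h.1, h.2.trans hle⟩⟩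
    rw [hev, measure_inter_perm_mem hU hUlaw hσmeas hσlaw hindep measurableSet_Iic, hint,
      Real.volume_Icc, sub_zero, ← ENNReal.ofReal_mul (by positivity)]
    congr 1
    have hN := card_precedingSet_eq (S.erase k) (Finset.notMem_erase k S)
    generalize (Finset.univ.filter fun π : Equiv.Perm (Fin n) =>
      precedingSet π k = S.erase k).card = N at hN ⊢
    have hS := Finset.card_erase_add_one hk
    unfold uniformCardWeight
    generalize (S.erase k).card = t at hN hS
    rw [← hS] at hSn ⊢
    obtain ⟨m, rfl⟩ := Nat.exists_eq_add_of_le hSn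
    rw [show t + 1 + m - t = m + 1 by omega, Nat.factorial_succ m, mul_left_comm] at hN
    have hN := Nat.eq_of_mul_eq_mul_left m.succ_pos hN
    rw [hN, Nat.add_sub_cancel_left, Nat.factorial_succ t, Nat.factorial_succ (t + 1 + m)]
    push_cast
    field_simp
  · have hlt : S.card < n := by
      simpa using Finset.card_lt_univ_of_notMem hk
    have hev : {ω | lindSet U σ k ω = S} = {ω | U ω ∈ Set.Ioi (((S.card : ℝ) + 1) / (n + 1)) ∧
        σ ω ∈ Finset.univ.filter fun π => precedingSet π k = S} := by
      ext ω
      simp [lindSet_eq_iff_of_notMem U σ hk]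
    have hint : Set.Ioi (((S.card : ℝ) + 1) / (n + 1)) ∩ Set.Icc 0 1 =
        Set.Ioc (((S.card : ℝ) + 1) / (n + 1)) 1 := by
      have hle : 0 ≤ ((S.card : ℝ) + 1) / (n + 1) := by positivity
      ext x
      simp only [Set.mem_inter_iff, Set.mem_Ioi, Set.mem_Icc, Set.mem_Ioc]
      exact ⟨fun h => ⟨h.1, h.2.2⟩, fun h => ⟨h.1, hle.trans h.1.le, h.2⟩⟩
    rw [hev, measure_inter_perm_mem hU hUlaw hσmeas hσlaw hindep measurableSet_Ioi, hint,
      Real.volume_Ioc, ← ENNReal.ofReal_mul' (by positivity)]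
    congr 1
    have hN := card_precedingSet_eq S hk
    generalize (Finset.univ.filter fun π : Equiv.Perm (Fin n) =>
      precedingSet π k = S).card = N at hN ⊢
    unfold uniformCardWeight
    rw [← Nat.cast_mul, ← hN]
    generalize S.card = t at hlt
    obtain ⟨m, rfl⟩ := Nat.exists_eq_add_of_le hlt.le
    rw [Nat.add_sub_cancel_left, Nat.factorial_succ]
    push_cast
    field_simp
    ring

end

/-- If `A` has law `P'` on a countable discrete space, then `g ∘ A` has the law of `g` under
`P'`. -/
lemma map_comp_eq_map_of_forall_singleton {Ω α β : Type*} [MeasurableSpace Ω]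
    [MeasurableSpace α] [DiscreteMeasurableSpace α] [Countable α] [MeasurableSpace β]
    {P : Measure Ω} {P' : Measure α} {A : Ω → α} (hA : ∀ a, MeasurableSet {ω | A ω = a})
    (h : ∀ a, P {ω | A ω = a} = P' {a}) (g : α → β) :
    Measure.map (g ∘ A) P = Measure.map g P' := by
  have hAm : Measurable A := measurable_to_countable' hA
  rw [← Measure.map_map (Measurable.of_discrete) hAm]
  congr 1
  refine Measure.ext_of_singleton fun a => ?_
  rw [Measure.map_apply hAm (measurableSet_singleton a)]
  exact h a

/-- **Randomized Lindeberg interpolation** (Lemma 7.2 / `lem: rand lind`).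
With `U` uniform on `[0,1]` and `σ` uniform on permutations, independent of each
other, the distribution of `W_k` does not depend on `k`; moreover there is a random
vector `ε ∈ {0,1}^n` (on some probability space) such that each `W_k` is distributed
as `Σ_i (ε_i X_i + (1−ε_i) Y_i)`, the `ε_i` are exchangeable,
`P(Σ ε_i = s) = 1/(n+1)` for `s = 0,…,n`, and `E[Σ ε_i] = n/2`. -/
theorem randomized_lindeberg_interpolation
    {Ω : Type} [MeasurableSpace Ω] (P : Measure Ω) [IsProbabilityMeasure P]
    (n p : ℕ) (X Y : Fin n → Fin p → ℝ)
    (U : Ω → ℝ) (σ : Ω → Equiv.Perm (Fin n))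
    (hU : Measurable U)
    (hUlaw : Measure.map U P = volume.restrict (Set.Icc (0 : ℝ) 1))
    (hσmeas : ∀ π : Equiv.Perm (Fin n), MeasurableSet {ω | σ ω = π})
    (hσlaw : ∀ π : Equiv.Perm (Fin n),
      P {ω | σ ω = π} = ((Nat.factorial n : ENNReal))⁻¹)
    (hindep : ∀ s : Set ℝ, MeasurableSet s → ∀ π : Equiv.Perm (Fin n),
      P ({ω | U ω ∈ s} ∩ {ω | σ ω = π}) = P {ω | U ω ∈ s} * P {ω | σ ω = π}) :
    (∀ k k' : Fin n,
      Measure.map (lindW X Y U σ k) P = Measure.map (lindW X Y U σ k') P) ∧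
    ∃ (Ω' : Type) (_ : MeasurableSpace Ω') (P' : Measure Ω'),
      IsProbabilityMeasure P' ∧
      ∃ ε : Ω' → Fin n → ℝ, Measurable ε ∧
        (∀ ω' i, ε ω' i = 0 ∨ ε ω' i = 1) ∧
        (∀ k : Fin n,
          Measure.map (lindW X Y U σ k) P =
            Measure.map
              (fun ω' (j : Fin p) => ∑ i, (ε ω' i * X i j + (1 - ε ω' i) * Y i j)) P') ∧
        (∀ π : Equiv.Perm (Fin n),
          Measure.map (fun ω' (i : Fin n) => ε ω' (π i)) P' = Measure.map ε P') ∧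
        (∀ s : ℕ, s ≤ n → P' {ω' | (∑ i, ε ω' i) = (s : ℝ)} = ((n : ENNReal) + 1)⁻¹) ∧
        (∫ ω', ∑ i, ε ω' i ∂P') = n / 2 := by
  let _ : MeasurableSpace (Finset (Fin n)) := ⊤
  have hmap (k : Fin n) : Measure.map (lindW X Y U σ k) P =
      Measure.map (mixedSum X Y) (uniformCardPMF n).toMeasure := by
    rw [lindW_eq_mixedSum]
    refine map_comp_eq_map_of_forall_singleton (measurableSet_lindSet_eq hU hσmeas k)
      (fun S => ?_) _
    rw [measure_lindSet_eq hU hUlaw hσmeas hσlaw hindep, PMF.toMeasure_apply_singleton _ _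
      (measurableSet_singleton S), uniformCardPMF_apply]
  have hsum (S : Finset (Fin n)) : ∑ i, (if i ∈ S then 1 else 0 : ℝ) = S.card := by simp
  refine ⟨fun k k' => (hmap k).trans (hmap k').symm, Finset (Fin n), inferInstance,
    (uniformCardPMF n).toMeasure, inferInstance, fun S i => if i ∈ S then 1 else 0,
    Measurable.of_discrete, fun S i => ?_, hmap, fun π => ?_, fun s hs => ?_, ?_⟩
  · by_cases h : i ∈ S <;> simp [h]
  · have hcomp : (fun (S : Finset (Fin n)) (i : Fin n) => if π i ∈ S then (1 : ℝ) else 0) =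
        (fun S i => if i ∈ S then 1 else 0) ∘ (fun S => S.map π.symm.toEmbedding) := by
      ext S i
      simp [Finset.mem_map_equiv]
    rw [hcomp]
    refine map_comp_eq_map_of_forall_singleton (fun _ => .of_discrete) (fun S => ?_) _
    have hev : {T : Finset (Fin n) | T.map π.symm.toEmbedding = S} = {S.map π.toEmbedding} := by
      ext T
      simp only [Set.mem_ofPred_eq, Set.mem_singleton_iff]
      constructor
      · rintro rfl
        ext
        simp [Finset.mem_map_equiv]
      · rintro rfl
        ext
        simp [Finset.mem_map_equiv]
    rw [hev, PMF.toMeasure_apply_singleton _ _ .of_discrete,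
      PMF.toMeasure_apply_singleton _ _ .of_discrete, uniformCardPMF_apply,
      uniformCardPMF_apply, uniformCardWeight, uniformCardWeight, Finset.card_map]
  · simp only [hsum, Nat.cast_inj]
    have h := sum_uniformCardWeight_mul (n := n) fun m => if m = s then 1 else 0
    rw [PMF.toMeasure_apply_fintype]
    have hind (S : Finset (Fin n)) : Set.indicator {S | S.card = s} (uniformCardPMF n) S =
        ENNReal.ofReal (uniformCardWeight S * if S.card = s then 1 else 0) := by
      by_cases hS : S.card = s <;> simp [hS, uniformCardPMF_apply]
    simp only [hind]
    rw [← ENNReal.ofReal_sum_of_nonneg, h]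
    · simp only [ite_div, zero_div, Finset.sum_ite_eq', Finset.mem_range, Nat.lt_succ_iff, hs,
        if_true]
      rw [one_div, ENNReal.ofReal_inv_of_pos (by positivity),
        ENNReal.ofReal_add (by positivity) zero_le_one]
      simp
    · intro S _
      exact mul_nonneg (uniformCardWeight_nonneg S) (by split_ifs <;> simp)
  · have h := sum_uniformCardWeight_mul (n := n) fun m => m
    have hid : ∑ s ∈ Finset.range (n + 1), (s : ℝ) = n * (n + 1) / 2 := by
      have := Finset.sum_range_id_mul_two (n + 1)
      rw [Nat.add_sub_cancel] at this
      rw [eq_div_iff two_ne_zero, mul_comm (n : ℝ), ← Nat.cast_sum]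
      exact_mod_cast this
    rw [← Finset.sum_div, hid] at h
    simp only [hsum]
    rw [PMF.integral_eq_sum]
    simp only [uniformCardPMF_apply, ENNReal.toReal_ofReal (uniformCardWeight_nonneg _),
      smul_eq_mul]
    rw [h]
    field_simp
end

section
/- Let γ ∈ (0, 1/2 − 1/(2√5)) be a constant. Then σ = (1 − (1−γ)^{1/3} γ^{1/3} / (1−2γ)^{2/3})^{1/2} is a well-defined real number satisfying σ > 0. Moreover, with a = (1−γ)^{2/3} / (γ^{1/3} (1−2γ)^{1/3}) and b = − γ^{2/3} / ((1−γ)^{1/3} (1−2γ)^{1/3}), if e_1 and e_2 are independent random variables where e_1 ~ N(0, σ²) and e_2 takes values a and b with probabilities γ and 1−γ respectively, then the random variable e = e_1 + e_2 satisfies E[e] = 0, E[e²] = 1, and E[e³] = 1. -/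
open MeasureTheory ProbabilityTheory

/-- The Gaussian standard deviation of the third-order matching multiplier
construction: `σ = (1 − (1−γ)^{1/3} γ^{1/3} / (1−2γ)^{2/3})^{1/2}`. -/
noncomputable def multSigma (γ : ℝ) : ℝ :=
  Real.sqrt (1 - (1 - γ) ^ ((1 : ℝ) / 3) * γ ^ ((1 : ℝ) / 3) /
    (1 - 2 * γ) ^ ((2 : ℝ) / 3))

/-- `a = (1−γ)^{2/3} / (γ^{1/3}(1−2γ)^{1/3})`. -/
noncomputable def multA (γ : ℝ) : ℝ :=
  (1 - γ) ^ ((2 : ℝ) / 3) / (γ ^ ((1 : ℝ) / 3) * (1 - 2 * γ) ^ ((1 : ℝ) / 3))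

/-- `b = −γ^{2/3} / ((1−γ)^{1/3}(1−2γ)^{1/3})`. -/
noncomputable def multB (γ : ℝ) : ℝ :=
  -(γ ^ ((2 : ℝ) / 3) / ((1 - γ) ^ ((1 : ℝ) / 3) * (1 - 2 * γ) ^ ((1 : ℝ) / 3)))

/-- The two-point law of `e₂`: value `a` with probability `γ`, value `b` with
probability `1 − γ`. -/
noncomputable def twoPointLaw (γ : ℝ) : Measure ℝ :=
  ENNReal.ofReal γ • Measure.dirac (multA γ) +
    ENNReal.ofReal (1 - γ) • Measure.dirac (multB γ)

/-- The law of `e = e₁ + e₂` where `e₁ ~ N(0, σ²)` and `e₂` has the two-point law,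
independent. -/
noncomputable def thirdOrderMultiplierLaw (γ : ℝ) : Measure ℝ :=
  Measure.map (fun q : ℝ × ℝ => q.1 + q.2)
    ((gaussianReal 0 (Real.toNNReal ((multSigma γ) ^ 2))).prod (twoPointLaw γ))

open scoped NNReal

theorem integrable_pow_gaussianReal (m : ℝ) (v : ℝ≥0) (n : ℕ) :
    Integrable (fun x : ℝ => x ^ n) (gaussianReal m v) :=
  ((memLp_id_gaussianReal' (n : ENNReal) (ENNReal.natCast_ne_top n)).integrable_norm_pow'.mono'
    (by fun_prop) (ae_of_all _ fun x => (norm_pow x n).le))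

theorem integral_sq_gaussianReal (m : ℝ) (v : ℝ≥0) :
    ∫ x, x ^ 2 ∂(gaussianReal m v) = m ^ 2 + v := by
  have h := variance_eq_sub (memLp_id_gaussianReal' (μ := m) (v := v) 2 (by simp))
  simp only [variance_id_gaussianReal, Pi.pow_apply, id, integral_id_gaussianReal] at h
  linarith

theorem integral_cube_gaussianReal_zero (v : ℝ≥0) :
    ∫ x, x ^ 3 ∂(gaussianReal 0 v) = 0 := by
  have h : ∫ x, x ^ 3 ∂((gaussianReal 0 v).map fun x => -x) = ∫ x, (-x) ^ 3 ∂(gaussianReal 0 v) :=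
    integral_map (by fun_prop) (by fun_prop)
  rw [gaussianReal_map_neg, neg_zero] at h
  simp only [Odd.neg_pow (by decide : Odd 3), integral_neg] at h
  linarith

theorem integral_cube_gaussianReal (m : ℝ) (v : ℝ≥0) :
    ∫ x, x ^ 3 ∂(gaussianReal m v) = m ^ 3 + 3 * m * v := by
  have h : ∫ x, x ^ 3 ∂((gaussianReal 0 v).map fun x => x + m) =
      ∫ x, (x + m) ^ 3 ∂(gaussianReal 0 v) :=
    integral_map (by fun_prop) (by fun_prop)
  rw [gaussianReal_map_add_const, zero_add] at h
  have h1 := integrable_pow_gaussianReal 0 v 1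
  have h2 := integrable_pow_gaussianReal 0 v 2
  have h3 := integrable_pow_gaussianReal 0 v 3
  have expand (x : ℝ) : (x + m) ^ 3 = x ^ 3 + 3 * m * x ^ 2 + 3 * m ^ 2 * x ^ 1 + m ^ 3 := by ring
  simp only [expand] at h
  rw [h, integral_add (by fun_prop) (by fun_prop), integral_add (by fun_prop) (by fun_prop),
    integral_add (by fun_prop) (by fun_prop), integral_const_mul, integral_const_mul,
    integral_cube_gaussianReal_zero, integral_sq_gaussianReal]
  simp only [pow_one, integral_id_gaussianReal, integral_const, probReal_univ, smul_eq_mul]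
  ring

theorem thirdOrderMultiplierLaw_eq (γ : ℝ) :
    thirdOrderMultiplierLaw γ =
      ENNReal.ofReal γ • gaussianReal (multA γ) (Real.toNNReal (multSigma γ ^ 2)) +
        ENNReal.ofReal (1 - γ) •
          gaussianReal (multB γ) (Real.toNNReal (multSigma γ ^ 2)) := by
  have map_prod_dirac (v : ℝ≥0) (c : ℝ) :
      ((gaussianReal 0 v).prod (Measure.dirac c)).map (fun q : ℝ × ℝ => q.1 + q.2) =
        gaussianReal c v := by
    rw [Measure.prod_dirac, Measure.map_map (by fun_prop) (by fun_prop)]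
    exact (gaussianReal_map_add_const c).trans (by rw [zero_add])
  rw [thirdOrderMultiplierLaw, twoPointLaw, Measure.prod_add, Measure.prod_smul_right,
    Measure.prod_smul_right, Measure.map_add _ _ (by fun_prop), Measure.map_smul,
    Measure.map_smul, map_prod_dirac, map_prod_dirac]

theorem integral_pow_thirdOrderMultiplierLaw {γ : ℝ} (h0 : 0 ≤ γ) (h1 : γ ≤ 1) (n : ℕ) :
    ∫ x, x ^ n ∂(thirdOrderMultiplierLaw γ) =
      γ * ∫ x, x ^ n ∂(gaussianReal (multA γ) (Real.toNNReal (multSigma γ ^ 2))) +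
        (1 - γ) * ∫ x, x ^ n ∂(gaussianReal (multB γ) (Real.toNNReal (multSigma γ ^ 2))) := by
  rw [thirdOrderMultiplierLaw_eq, integral_add_measure
      ((integrable_pow_gaussianReal _ _ n).smul_measure ENNReal.ofReal_ne_top)
      ((integrable_pow_gaussianReal _ _ n).smul_measure ENNReal.ofReal_ne_top),
    integral_smul_measure, integral_smul_measure, ENNReal.toReal_ofReal h0,
    ENNReal.toReal_ofReal (sub_nonneg.mpr h1), smul_eq_mul, smul_eq_mul]

theorem rpow_one_third_pow_three {x : ℝ} (hx : 0 ≤ x) : (x ^ ((1 : ℝ) / 3)) ^ 3 = x := by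
  rw [← Real.rpow_natCast, ← Real.rpow_mul hx]
  norm_num

theorem rpow_two_thirds_eq {x : ℝ} (hx : 0 ≤ x) :
    x ^ ((2 : ℝ) / 3) = (x ^ ((1 : ℝ) / 3)) ^ 2 := by
  rw [← Real.rpow_natCast, ← Real.rpow_mul hx]
  norm_num

theorem multiplier_threshold {γ : ℝ} (hγ : γ < 1 / 2 - 1 / (2 * Real.sqrt 5)) :
    γ < 1 / 2 ∧ (1 - γ) * γ < (1 - 2 * γ) ^ 2 := by
  have hs : 0 < Real.sqrt 5 := by positivity
  have hsq : Real.sqrt 5 ^ 2 = 5 := Real.sq_sqrt (by norm_num)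
  have hpos : 0 < 1 / (2 * Real.sqrt 5) := by positivity
  have hinv : (1 / (2 * Real.sqrt 5)) ^ 2 = 1 / 20 := by
    rw [div_pow, mul_pow, hsq]
    norm_num
  constructor <;> nlinarith

/-- **Third-order matching multipliers with Gaussian component** (Lemma 7.3 /
`lem: multipliers`). For `γ ∈ (0, 1/2 − 1/(2√5))`, the quantity under the square
root defining `σ` is positive (so `σ > 0`), and the random variable `e = e₁ + e₂`
satisfies `E[e] = 0`, `E[e²] = 1`, and `E[e³] = 1`. -/
theorem third_order_matching_multipliers (γ : ℝ)
    (hγ : γ ∈ Set.Ioo (0 : ℝ) (1 / 2 - 1 / (2 * Real.sqrt 5))) :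
    0 < 1 - (1 - γ) ^ ((1 : ℝ) / 3) * γ ^ ((1 : ℝ) / 3) /
        (1 - 2 * γ) ^ ((2 : ℝ) / 3) ∧
      0 < multSigma γ ∧
      (∫ x, x ∂(thirdOrderMultiplierLaw γ)) = 0 ∧
      (∫ x, x ^ 2 ∂(thirdOrderMultiplierLaw γ)) = 1 ∧
      (∫ x, x ^ 3 ∂(thirdOrderMultiplierLaw γ)) = 1 := by
  obtain ⟨h0, hlt⟩ := hγ
  obtain ⟨hhalf, hthr⟩ := multiplier_threshold hlt
  have hpγ : 0 < 1 - γ := by linarith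
  have hrγ : 0 < 1 - 2 * γ := by linarith
  have hA := multA.eq_1 γ
  have hB := multB.eq_1 γ
  have hS := multSigma.eq_1 γ
  rw [rpow_two_thirds_eq hpγ.le] at hA
  rw [rpow_two_thirds_eq h0.le] at hB
  rw [rpow_two_thirds_eq hrγ.le] at hS
  rw [rpow_two_thirds_eq hrγ.le]
  have hp : 0 < (1 - γ) ^ ((1 : ℝ) / 3) := by positivity
  have hq : 0 < γ ^ ((1 : ℝ) / 3) := by positivity
  have hr : 0 < (1 - 2 * γ) ^ ((1 : ℝ) / 3) := by positivity
  have hp3 := rpow_one_third_pow_three hpγ.le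
  have hq3 := rpow_one_third_pow_three h0.le
  have hr3 := rpow_one_third_pow_three hrγ.le
  generalize (1 - γ) ^ ((1 : ℝ) / 3) = p at *
  generalize γ ^ ((1 : ℝ) / 3) = q at *
  generalize (1 - 2 * γ) ^ ((1 : ℝ) / 3) = r at *
  have hlt_sq : p * q < r ^ 2 := by
    refine lt_of_pow_lt_pow_left₀ 3 (by positivity) ?_
    calc (p * q) ^ 3 = (1 - γ) * γ := by rw [mul_pow, hp3, hq3]
      _ < (1 - 2 * γ) ^ 2 := hthr
      _ = (r ^ 2) ^ 3 := by rw [← hr3]; ring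
  have hvar : 0 < 1 - p * q / r ^ 2 := sub_pos.mpr ((div_lt_one (by positivity)).mpr hlt_sq)
  have hσ : 0 < multSigma γ := by rw [hS]; exact Real.sqrt_pos.mpr hvar
  have hσ2 : multSigma γ ^ 2 = 1 - p * q / r ^ 2 := by rw [hS, Real.sq_sqrt hvar.le]
  have hsum : q ^ 3 + p ^ 3 = 1 := by rw [hp3, hq3]; ring
  have hdiff : p ^ 3 - q ^ 3 = r ^ 3 := by rw [hp3, hq3, hr3]; ring
  have mean : γ * multA γ + (1 - γ) * multB γ = 0 := by
    rw [hA, hB, ← hp3, ← hq3]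
    field_simp
    ring
  have second : γ * multA γ ^ 2 + (1 - γ) * multB γ ^ 2 = p * q / r ^ 2 := by
    rw [hA, hB, ← hp3, ← hq3]
    field_simp
    linear_combination hsum
  have third : γ * multA γ ^ 3 + (1 - γ) * multB γ ^ 3 = 1 := by
    rw [hA, hB, ← hp3, ← hq3]
    field_simp
    linear_combination hdiff + (p ^ 3 - q ^ 3) * hsum
  have moment := integral_pow_thirdOrderMultiplierLaw h0.le (by linarith : γ ≤ 1)
  refine ⟨hvar, hσ, ?_, ?_, ?_⟩
  · have h := moment 1
    simp only [pow_one, integral_id_gaussianReal] at h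
    rw [h, mean]
  · rw [moment 2, integral_sq_gaussianReal, integral_sq_gaussianReal,
      Real.coe_toNNReal _ (sq_nonneg _), hσ2]
    linear_combination second
  · rw [moment 3, integral_cube_gaussianReal, integral_cube_gaussianReal,
      Real.coe_toNNReal _ (sq_nonneg _)]
    linear_combination third + 3 * multSigma γ ^ 2 * mean
end

section
/- Let 𝒳 be a set, X a random variable with values in 𝒳, and G a set of M one-to-one functions mapping 𝒳 onto 𝒳 such that (i) for all g ∈ G the distribution of g(X) equals that of X, (ii) g ∈ G implies g^{-1} ∈ G, and (iii) g_1, g_2 ∈ G implies g_2 ∘ g_1 ∈ G. Let T : 𝒳 → R and, for α ∈ (0,1), define φ(x) = 1 if Σ_{g ∈ G} 1{T(x) > T(g(x))} ≥ M(1−α) and φ(x) = 0 otherwise. Define χ(x) = max_{s ∈ R} |{g ∈ G : T(g(x)) = s}| / M. Then α − E[χ(X)] ≤ E[φ(X)] ≤ α. -/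
open MeasureTheory ProbabilityTheory

/-- At most `n - a` members of a finite family of size `n` have at least `a` members strictly
below them. -/
lemma card_filter_le_card_lt_le {ι : Type*} (s : Finset ι) (y : ι → ℝ) {a : ℝ}
    (ha : a ≤ s.card) :
    ((s.filter fun h => a ≤ ((s.filter fun g => y g < y h).card : ℝ)).card : ℝ) ≤ s.card - a := by
  classical
  set S := s.filter fun h => a ≤ ((s.filter fun g => y g < y h).card : ℝ) with hS
  rcases S.eq_empty_or_nonempty with h | h
  · simp [h, ha]
  · obtain ⟨m, hm, hmin⟩ := S.exists_min_image y h
    have hdisj : Disjoint S (s.filter fun g => y g < y m) := by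
      rw [Finset.disjoint_left]
      intro g hg hg'
      exact absurd (Finset.mem_filter.1 hg').2 (not_lt.2 (hmin g hg))
    have hcard : S.card + (s.filter fun g => y g < y m).card ≤ s.card := by
      rw [← Finset.card_union_of_disjoint hdisj]
      exact Finset.card_le_card
        (Finset.union_subset (Finset.filter_subset _ _) (Finset.filter_subset _ _))
    have hcard' : (S.card : ℝ) + ((s.filter fun g => y g < y m).card : ℝ) ≤ s.card := by
      exact_mod_cast hcard
    linarith [(Finset.mem_filter.1 hm).2]

/-- At least `n - a - t` members of a finite family of size `n` have at least `a` members strictly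
below them, where `t` is the largest multiplicity of a value. -/
lemma le_card_filter_le_card_lt {ι : Type*} (s : Finset ι) (y : ι → ℝ) {a : ℝ}
    (ha : 0 ≤ a) :
    (s.card : ℝ) - a - ((s.sup fun g => (s.filter fun g' => y g' = y g).card : ℕ) : ℝ) ≤
      ((s.filter fun h => a ≤ ((s.filter fun g => y g < y h).card : ℝ)).card : ℝ) := by
  classical
  have hsplit := Finset.card_filter_add_card_filter_not (s := s)
    (fun h => a ≤ ((s.filter fun g => y g < y h).card : ℝ))
  set S := s.filter fun h => a ≤ ((s.filter fun g => y g < y h).card : ℝ) with hS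
  set N := s.filter fun h => ¬ a ≤ ((s.filter fun g => y g < y h).card : ℝ) with hN
  have hsplit' : (S.card : ℝ) + N.card = s.card := by exact_mod_cast hsplit
  set t := s.sup fun g => (s.filter fun g' => y g' = y g).card with ht
  have ht0 : (0 : ℝ) ≤ t := Nat.cast_nonneg t
  rcases N.eq_empty_or_nonempty with h | h
  · rw [h] at hsplit'
    simp only [Finset.card_empty, Nat.cast_zero, add_zero] at hsplit'
    linarith
  · obtain ⟨m, hm, hmax⟩ := N.exists_max_image y h
    have hms := Finset.mem_filter.1 hm
    have hsub : N ⊆ (s.filter fun g => y g < y m) ∪ (s.filter fun g => y g = y m) := by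
      intro g hg
      have hgs := (Finset.mem_filter.1 hg).1
      rcases (hmax g hg).lt_or_eq with hlt | heq
      · exact Finset.mem_union_left _ (Finset.mem_filter.2 ⟨hgs, hlt⟩)
      · exact Finset.mem_union_right _ (Finset.mem_filter.2 ⟨hgs, heq⟩)
    have hcard := (Finset.card_le_card hsub).trans (Finset.card_union_le _ _)
    have htie : (s.filter fun g => y g = y m).card ≤ t :=
      Finset.le_sup (f := fun g => (s.filter fun g' => y g' = y g).card) hms.1
    have hcard' : (N.card : ℝ) ≤ ((s.filter fun g => y g < y m).card : ℝ) + t := by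
      exact_mod_cast hcard.trans (Nat.add_le_add_left htie _)
    linarith [not_le.1 hms.2]

/-- Right translation by a member `h` permutes a finite set of bijections closed under composition
and inversion. -/
lemma card_filter_apply_apply {𝒳 : Type*} (G : Finset (𝒳 ≃ 𝒳))
    (hinv : ∀ g ∈ G, Equiv.symm g ∈ G)
    (hcomp : ∀ g₁ ∈ G, ∀ g₂ ∈ G, Equiv.trans g₁ g₂ ∈ G)
    (p : 𝒳 → Prop) [DecidablePred p] {h : 𝒳 ≃ 𝒳} (hh : h ∈ G) (x : 𝒳) :
    (G.filter fun g => p (g (h x))).card = (G.filter fun g => p (g x)).card := by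
  refine Finset.card_bij' (fun g _ => h.trans g) (fun g _ => h.symm.trans g) ?_ ?_ ?_ ?_
  · intro g hg
    rw [Finset.mem_filter] at hg ⊢
    exact ⟨hcomp _ hh _ hg.1, hg.2⟩
  · intro g hg
    rw [Finset.mem_filter] at hg ⊢
    exact ⟨hcomp _ (hinv _ hh) _ hg.1, by simpa using hg.2⟩
  · intro g _
    ext z
    simp
  · intro g _
    ext z
    simp

lemma measurable_card_filter {𝒳 ι : Type*} [MeasurableSpace 𝒳] (s : Finset ι)
    (p : ι → 𝒳 → Prop) [∀ x, DecidablePred fun i => p i x]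
    (hp : ∀ i ∈ s, MeasurableSet {x | p i x}) :
    Measurable fun x => (s.filter fun i => p i x).card := by
  simp only [Finset.card_filter]
  refine Finset.measurable_sum s fun i hi => ?_
  exact Measurable.ite (hp i hi) measurable_const measurable_const

/-- **Randomization tests with mass points** (Lemma 7.4 / `lem: rand test`).
Let `G` be a finite set of `M` bijections of `𝒳` closed under inversion and
composition, each leaving the distribution of `X` invariant.  With
`φ(x) = 1{Σ_{g∈G} 1{T(x) > T(g x)} ≥ M(1−α)}` and
`χ(x) = max_s |{g ∈ G : T(g x) = s}|/M`, one has
`α − E[χ(X)] ≤ E[φ(X)] ≤ α`. -/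
theorem randomization_test_mass_points
    {𝒳 : Type} [MeasurableSpace 𝒳]
    {Ω : Type} [MeasurableSpace Ω] (P : Measure Ω) [IsProbabilityMeasure P]
    (X : Ω → 𝒳) (hX : Measurable X)
    (G : Finset (𝒳 ≃ 𝒳)) (hG : G.Nonempty)
    (hGmeas : ∀ g ∈ G, Measurable (g : 𝒳 → 𝒳))
    (hinv : ∀ g ∈ G, Equiv.symm g ∈ G)
    (hcomp : ∀ g₁ ∈ G, ∀ g₂ ∈ G, Equiv.trans g₁ g₂ ∈ G)
    (hdist : ∀ g ∈ G, Measure.map (fun ω => g (X ω)) P = Measure.map X P)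
    (T : 𝒳 → ℝ) (hT : Measurable T)
    (α : ℝ) (hα : α ∈ Set.Ioo (0 : ℝ) 1) :
    α - (∫ ω, ((G.sup fun g =>
          (G.filter fun g' => T (g' (X ω)) = T (g (X ω))).card : ℕ) : ℝ) / G.card ∂P) ≤
      (∫ ω, (if (G.card : ℝ) * (1 - α) ≤
          ((G.filter fun g => T (g (X ω)) < T (X ω)).card : ℝ)
        then (1 : ℝ) else 0) ∂P) ∧
    (∫ ω, (if (G.card : ℝ) * (1 - α) ≤
        ((G.filter fun g => T (g (X ω)) < T (X ω)).card : ℝ)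
      then (1 : ℝ) else 0) ∂P) ≤ α := by
  obtain ⟨hα0, hα1⟩ := hα
  have hM : (0 : ℝ) < G.card := by exact_mod_cast hG.card_pos
  have ha0 : 0 ≤ (G.card : ℝ) * (1 - α) := mul_nonneg hM.le (by linarith)
  have haM : (G.card : ℝ) * (1 - α) ≤ G.card := by nlinarith
  set φ : 𝒳 → ℝ := fun x => if (G.card : ℝ) * (1 - α) ≤
    ((G.filter fun g => T (g x) < T x).card : ℝ) then (1 : ℝ) else 0 with hφ
  set τ : 𝒳 → ℕ := fun x =>
    G.sup fun g => (G.filter fun g' => T (g' x) = T (g x)).card with hτ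
  have hTg : ∀ g ∈ G, Measurable fun x => T (g x) := fun g hg => hT.comp (hGmeas g hg)
  have hφm : Measurable φ := by
    refine Measurable.ite ?_ measurable_const measurable_const
    refine measurableSet_le measurable_const (measurable_from_nat.comp
      (measurable_card_filter G (fun g x => T (g x) < T x) fun g hg => ?_))
    exact measurableSet_lt (hTg g hg) hT
  have hτm : Measurable τ := by
    have : τ = G.sup fun g x => (G.filter fun g' => T (g' x) = T (g x)).card := by
      ext x
      rw [Finset.sup_apply]
    rw [this]
    refine Finset.sup_induction (p := Measurable) measurable_const
      (fun _ h₁ _ h₂ => h₁.sup h₂) fun g hg =>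
      measurable_card_filter G (fun g' x => T (g' x) = T (g x)) fun g' hg' => ?_
    exact measurableSet_eq_fun (hTg g' hg') (hTg g hg)
  have hφbound : ∀ x, ‖φ x‖ ≤ 1 := by
    intro x
    simp only [hφ]
    split_ifs <;> simp
  have hφint : ∀ g ∈ G, Integrable (fun ω => φ (g (X ω))) P := fun g hg =>
    Integrable.of_bound ((hφm.comp ((hGmeas g hg).comp hX)).aestronglyMeasurable) 1
      (ae_of_all _ fun ω => hφbound _)
  have hτint : Integrable (fun ω => (τ (X ω) : ℝ) / G.card) P := by
    refine Integrable.of_bound (C := 1) ?_ (ae_of_all _ fun ω => ?_)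
    · exact ((measurable_from_nat.comp (hτm.comp hX)).div_const _).aestronglyMeasurable
    · rw [Real.norm_of_nonneg (by positivity), div_le_one hM]
      exact_mod_cast Finset.sup_le fun g _ => Finset.card_filter_le _ _
  have hEφ : ∀ g ∈ G, ∫ ω, φ (g (X ω)) ∂P = ∫ ω, φ (X ω) ∂P := by
    intro g hg
    rw [← integral_map hX.aemeasurable hφm.aestronglyMeasurable, ← hdist g hg,
      integral_map (φ := fun ω => g (X ω)) ((hGmeas g hg).comp hX).aemeasurable
        hφm.aestronglyMeasurable]
  have hsumφ : ∀ x, ∑ h ∈ G, φ (h x) = ((G.filter fun h => (G.card : ℝ) * (1 - α) ≤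
      ((G.filter fun g => T (g x) < T (h x)).card : ℝ)).card : ℝ) := by
    intro x
    rw [Finset.card_filter, Nat.cast_sum]
    refine Finset.sum_congr rfl fun h hh => ?_
    simp only [hφ]
    rw [card_filter_apply_apply G hinv hcomp (fun z => T z < T (h x)) hh x]
    push_cast
    rfl
  have hEsum : ∫ ω, (∑ h ∈ G, φ (h (X ω))) / G.card ∂P = ∫ ω, φ (X ω) ∂P := by
    rw [integral_div, integral_finsetSum G hφint, Finset.sum_congr rfl hEφ, Finset.sum_const,
      nsmul_eq_mul, mul_div_cancel_left₀ _ hM.ne']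
  have hsumint : Integrable (fun ω => (∑ h ∈ G, φ (h (X ω))) / G.card) P :=
    (integrable_finsetSum G hφint).div_const _
  change α - ∫ ω, (τ (X ω) : ℝ) / G.card ∂P ≤ ∫ ω, φ (X ω) ∂P ∧ ∫ ω, φ (X ω) ∂P ≤ α
  rw [← hEsum]
  have hconst : ∫ _ω, α ∂P = α := by simp
  constructor
  · calc α - ∫ ω, (τ (X ω) : ℝ) / G.card ∂P
        = ∫ ω, (α - (τ (X ω) : ℝ) / G.card) ∂P := by
          rw [integral_sub (integrable_const α) hτint, hconst]
      _ ≤ _ := by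
          refine integral_mono ((integrable_const α).sub hτint) hsumint fun ω => ?_
          have := le_card_filter_le_card_lt G (fun g => T (g (X ω))) ha0
          rw [← hsumφ] at this
          change α - (τ (X ω) : ℝ) / G.card ≤ (∑ h ∈ G, φ (h (X ω))) / G.card
          rw [le_div_iff₀ hM, sub_mul, div_mul_cancel₀ _ hM.ne']
          change (G.card : ℝ) - _ - (τ (X ω) : ℝ) ≤ _ at this
          linarith
  · refine (integral_mono hsumint (integrable_const α) fun ω => ?_).trans hconst.le
    have := card_filter_le_card_lt_le G (fun g => T (g (X ω))) haM
    rw [← hsumφ] at this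
    change (∑ h ∈ G, φ (h (X ω))) / G.card ≤ α
    rw [div_le_iff₀ hM]
    linarith
end
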